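/- arXiv:1002.2086 — 4 statements merged into one kernel-verified Lean document; each statement's English description precedes it below -/
import Mathlib

section
/- Let U be a nonempty finite type (equipped with the σ-algebra of all subsets), fix i ∈ U, x ∈ ℝ, σ > 0, and real numbers m̲ ≤ m̄. For a stochastic vector p : U → [0,1] with Σ_{j∈U} p(j) = 1 and m ∈ [m̲, m̄], let μ_{p,m} be the Borel probability measure on U × ℝ given by μ_{p,m} = Σ_{j∈U} p(j) · (δ_j ⊗ N(x+m, σ²)), where N(x+m, σ²) is the real Gaussian measure with mean x+m and variance σ². Then the set S = { μ_{p,m} : p a stochastic vector on U, m ∈ [m̲, m̄] } ∪ { δ_{(i,x)} } is compact (and hence closed) in the topology of weak convergence of probability measures on U × ℝ. -/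
open MeasureTheory ProbabilityTheory

/-- The stochastic vectors on a finite type form a compact set. -/
lemma isCompact_setOf_sum_eq_one {U : Type*} [Fintype U] :
    IsCompact {p : U → NNReal | ∑ j, p j = 1} := by
  refine (isCompact_univ_pi fun _ : U ↦ isCompact_Icc (a := (0 : NNReal)) (b := 1)).of_isClosed_subset
    (isClosed_eq (by fun_prop) continuous_const) fun p hp j _ ↦ ⟨zero_le, ?_⟩
  rw [← show ∑ j, p j = 1 from hp]
  exact Finset.single_le_sum (fun _ _ ↦ zero_le) (Finset.mem_univ j)

/-- The integral of a bounded continuous function against a real Gaussian measure depends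
continuously on the mean. -/
lemma continuous_integral_gaussianReal (f : BoundedContinuousFunction ℝ ℝ) (v : NNReal) :
    Continuous fun m : ℝ ↦ ∫ y, f y ∂(gaussianReal m v) := by
  have h (m : ℝ) : ∫ y, f y ∂(gaussianReal m v) = ∫ y, f (y + m) ∂(gaussianReal 0 v) := by
    rw [← zero_add m, ← gaussianReal_map_add_const,
      integral_map (by fun_prop) (by fun_prop), zero_add]
  simp_rw [h]
  exact continuous_of_dominated (bound := fun _ ↦ ‖f‖) (fun _ ↦ by fun_prop)
    (fun _ ↦ .of_forall fun _ ↦ f.norm_coe_le_norm _) (integrable_const _)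
    (.of_forall fun _ ↦ by fun_prop)

/-- Finite mixtures of measures with weights summing to one are probability measures. -/
lemma isProbabilityMeasure_sum_smul {U Ω : Type*} [Fintype U] [MeasurableSpace Ω]
    (p : U → NNReal) (hp : ∑ j, p j = 1) (ν : U → Measure Ω) [∀ j, IsProbabilityMeasure (ν j)] :
    IsProbabilityMeasure (∑ j, p j • ν j) := by
  constructor
  simp only [Measure.finsetSum_apply, Measure.smul_apply, measure_univ, ENNReal.smul_def,
    smul_eq_mul, mul_one]
  exact_mod_cast hp

/-- The integral of a bounded continuous function against a mixture of products of Dirac and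
Gaussian measures, as a finite sum. -/
lemma integral_sum_smul_dirac_prod_gaussianReal {U : Type*} [Fintype U]
    [TopologicalSpace U] [DiscreteTopology U] [MeasurableSpace U] [BorelSpace U]
    (f : BoundedContinuousFunction (U × ℝ) ℝ) (p : U → NNReal) (m : ℝ) (v : NNReal) :
    ∫ z, f z ∂(∑ j, p j • ((Measure.dirac j).prod (gaussianReal m v))) =
      ∑ j, (p j : ℝ) * ∫ y, f (j, y) ∂(gaussianReal m v) := by
  rw [integral_finsetSum_measure fun j _ ↦ f.integrable _]
  refine Finset.sum_congr rfl fun j _ ↦ ?_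
  rw [integral_smul_nnreal_measure, Measure.dirac_prod,
    integral_map (by fun_prop) (by fun_prop), NNReal.smul_def, smul_eq_mul]

/-- the set of transition laws
`μ_{p,m} = ∑_j p j • (δ_j ⊗ N(x+m, σ²))`, for `p` a stochastic vector on the finite set `U`
and `m ∈ [mlo, mhi]`, together with the Dirac mass `δ_{(i,x)}`, is a compact subset of the
space of probability measures on `U × ℝ` for the topology of weak convergence. -/
theorem stmt3 {U : Type*} [Fintype U] [Nonempty U]
    [TopologicalSpace U] [DiscreteTopology U] [MeasurableSpace U] [BorelSpace U]
    (i : U) (x : ℝ) (σ : NNReal) (hσ : 0 < σ) (mlo mhi : ℝ) (hm : mlo ≤ mhi) :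
    IsCompact {μ : ProbabilityMeasure (U × ℝ) |
      (∃ (p : U → NNReal) (m : ℝ), (∑ j, p j) = 1 ∧ m ∈ Set.Icc mlo mhi ∧
        (μ : Measure (U × ℝ)) =
          ∑ j, p j • ((Measure.dirac j).prod (gaussianReal (x + m) (σ ^ 2)))) ∨
      (μ : Measure (U × ℝ)) = Measure.dirac (i, x)} := by
  let K : Set ((U → NNReal) × ℝ) := {p | ∑ j, p j = 1} ×ˢ Set.Icc mlo mhi
  have hK : IsCompact K := isCompact_setOf_sum_eq_one.prod isCompact_Icc
  let F : K → ProbabilityMeasure (U × ℝ) := fun q ↦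
    ⟨∑ j, q.1.1 j • ((Measure.dirac j).prod (gaussianReal (x + q.1.2) (σ ^ 2))),
      isProbabilityMeasure_sum_smul _ q.2.1 _⟩
  have hF : Continuous F := by
    refine continuous_iff_continuousAt.2 fun q ↦
      ProbabilityMeasure.tendsto_iff_forall_integral_tendsto.2 fun f ↦ ?_
    have hf : Continuous fun q : K ↦ ∫ z, f z ∂(F q : Measure (U × ℝ)) := by
      simp only [F, ProbabilityMeasure.coe_mk, integral_sum_smul_dirac_prod_gaussianReal]
      refine continuous_finsetSum _ fun j _ ↦ .mul (by fun_prop) ?_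
      exact (continuous_integral_gaussianReal
        (f.compContinuous ⟨fun y ↦ (j, y), by fun_prop⟩) (σ ^ 2)).comp
        (f := fun q : K ↦ x + q.1.2) (by fun_prop)
    exact hf.tendsto q
  have := isCompact_iff_compactSpace.1 hK
  convert! (isCompact_range hF).union (isCompact_singleton (x := diracProba (i, x))) using 1
  ext μ
  refine or_congr ⟨?_, ?_⟩ ⟨fun h ↦ Subtype.ext h, fun h ↦ congrArg _ h⟩
  · rintro ⟨p, m, hp, hm, h⟩
    exact ⟨⟨(p, m), hp, hm⟩, Subtype.ext h.symm⟩
  · rintro ⟨⟨⟨p, m⟩, hp, hm⟩, rfl⟩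
    exact ⟨p, m, hp, hm, rfl⟩
end

section
/- Let (Ω, 𝓕, P) be a probability space and 𝓖 ⊆ 𝓕 a sub-σ-algebra. Let (X_i)_{i∈I} be a nonempty family of integrable real random variables that is upward directed: for all i, j ∈ I there exists k ∈ I with max(X_i, X_j) ≤ X_k almost surely. Let g be an integrable random variable that is an essential supremum of the family, i.e. X_i ≤ g almost surely for every i, and g ≤ h almost surely for every measurable h satisfying X_i ≤ h almost surely for every i. Then E[g | 𝓖] is an essential supremum of the family (E[X_i | 𝓖])_{i∈I}: E[X_i | 𝓖] ≤ E[g | 𝓖] almost surely for every i ∈ I, and for every 𝓖-measurable h with E[X_i | 𝓖] ≤ h almost surely for every i ∈ I, one has E[g | 𝓖] ≤ h almost surely. (In other words, the essential supremum commutes with conditional expectation for upward-directed families.) -/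
open MeasureTheory

theorem ae_le_of_lintegral_ofReal_sub_eq_zero {α : Type*} {mα : MeasurableSpace α}
    {μ : Measure α} {u v : α → ℝ} (hu : AEMeasurable u μ) (hv : AEMeasurable v μ)
    (h : ∫⁻ x, ENNReal.ofReal (u x - v x) ∂μ = 0) : ∀ᵐ x ∂μ, u x ≤ v x := by
  have hzero := (lintegral_eq_zero_iff' (hu.sub hv).ennreal_ofReal).1 h
  filter_upwards [hzero] with x hx
  exact sub_nonpos.1 (ENNReal.ofReal_eq_zero.1 hx)

/-- An upward-directed family of integrable functions contains members whose integral is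
arbitrarily close to the integral of its essential supremum. -/
theorem exists_integral_lt_of_directed_essSup {Ω I : Type*} {mΩ : MeasurableSpace Ω}
    {P : Measure Ω} [Nonempty I] {X : I → Ω → ℝ} (hX_int : ∀ i, Integrable (X i) P)
    (hdir : ∀ i j : I, ∃ k : I, ∀ᵐ ω ∂P, max (X i ω) (X j ω) ≤ X k ω)
    {g : Ω → ℝ} (hg_int : Integrable g P) (hg_ub : ∀ i, ∀ᵐ ω ∂P, X i ω ≤ g ω)
    (hg_lub : ∀ h : Ω → ℝ, Measurable h → (∀ i, ∀ᵐ ω ∂P, X i ω ≤ h ω) →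
      ∀ᵐ ω ∂P, g ω ≤ h ω) {ε : ℝ} (hε : 0 < ε) :
    ∃ i, ∫ ω, g ω ∂P - ∫ ω, X i ω ∂P < ε := by
  set c : ℝ := ⨆ i, ∫ ω, X i ω ∂P
  have hbdd : BddAbove (Set.range fun i => ∫ ω, X i ω ∂P) :=
    ⟨∫ ω, g ω ∂P, by
      rintro _ ⟨i, rfl⟩
      exact integral_mono_ae (hX_int i) hg_int (hg_ub i)⟩
  have hle_c : ∀ i, ∫ ω, X i ω ∂P ≤ c := fun i => le_ciSup hbdd i
  have hnear : ∀ n : ℕ, ∃ i, c - 1 / ((n : ℝ) + 1) < ∫ ω, X i ω ∂P := fun n =>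
    exists_lt_of_lt_ciSup (sub_lt_self _ Nat.one_div_pos_of_nat)
  choose s hs using hnear
  choose d hd using hdir
  let j : ℕ → I := fun n => Nat.rec (s 0) (fun n a => d a (s (n + 1))) n
  have hj_step : ∀ n, X (j n) ≤ᵐ[P] X (j (n + 1)) := fun n => by
    filter_upwards [hd (j n) (s (n + 1))] with ω hω
    exact (le_max_left _ _).trans hω
  have hj_near : ∀ n : ℕ, c - 1 / ((n : ℝ) + 1) < ∫ ω, X (j n) ω ∂P := by
    intro n
    cases n with
    | zero => exact hs 0
    | succ n =>
      refine (hs (n + 1)).trans_le (integral_mono_ae (hX_int _) (hX_int _) ?_)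
      filter_upwards [hd (j n) (s (n + 1))] with ω hω
      exact (le_max_right _ _).trans hω
  have hmono : ∀ᵐ ω ∂P, Monotone fun n => X (j n) ω := by
    filter_upwards [ae_all_iff.2 hj_step] with ω hω
    exact monotone_nat_of_le_succ hω
  have hbdd_ae : ∀ᵐ ω ∂P, BddAbove (Set.range fun n => X (j n) ω) := by
    filter_upwards [ae_all_iff.2 fun n => hg_ub (j n)] with ω hω
    exact ⟨g ω, by rintro _ ⟨n, rfl⟩; exact hω n⟩
  have hY_meas : AEMeasurable (fun ω => ⨆ n, X (j n) ω) P :=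
    AEMeasurable.iSup fun n => (hX_int (j n)).aemeasurable
  have hX_le : ∀ i, ∀ᵐ ω ∂P, X i ω ≤ ⨆ n, X (j n) ω := by
    intro i
    have hsmall : ∀ n : ℕ,
        ∫⁻ ω, ENNReal.ofReal (X i ω - ⨆ n, X (j n) ω) ∂P ≤
          ENNReal.ofReal (1 / ((n : ℝ) + 1)) := by
      intro n
      have hk := hd i (j n)
      have hnonneg : 0 ≤ᵐ[P] fun ω => X (d i (j n)) ω - X (j n) ω := by
        filter_upwards [hk] with ω hω
        exact sub_nonneg.2 ((le_max_right _ _).trans hω)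
      calc
        _ ≤ ∫⁻ ω, ENNReal.ofReal (X (d i (j n)) ω - X (j n) ω) ∂P := by
          apply lintegral_mono_ae
          filter_upwards [hk, hbdd_ae] with ω hω hb
          exact ENNReal.ofReal_le_ofReal
            (sub_le_sub ((le_max_left _ _).trans hω) (le_ciSup hb n))
        _ = ENNReal.ofReal (∫ ω, (X (d i (j n)) ω - X (j n) ω) ∂P) :=
          (ofReal_integral_eq_lintegral_ofReal ((hX_int _).sub (hX_int _)) hnonneg).symm
        _ ≤ _ := by
          apply ENNReal.ofReal_le_ofReal
          rw [integral_sub (hX_int _) (hX_int _)]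
          linarith [hle_c (d i (j n)), hj_near n]
    have htendsto := ENNReal.tendsto_ofReal (tendsto_one_div_add_atTop_nhds_zero_nat (𝕜 := ℝ))
    rw [ENNReal.ofReal_zero] at htendsto
    have hzero : ∫⁻ ω, ENNReal.ofReal (X i ω - ⨆ n, X (j n) ω) ∂P = 0 :=
      le_antisymm (ge_of_tendsto' htendsto hsmall) zero_le
    exact ae_le_of_lintegral_ofReal_sub_eq_zero (hX_int i).aemeasurable hY_meas hzero
  have hg_le : ∀ᵐ ω ∂P, g ω ≤ ⨆ n, X (j n) ω := by
    have hmk := hg_lub (hY_meas.mk _) hY_meas.measurable_mk fun i => by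
      filter_upwards [hX_le i, hY_meas.ae_eq_mk] with ω hω he
      exact hω.trans_eq he
    filter_upwards [hmk, hY_meas.ae_eq_mk] with ω hω he
    exact hω.trans_eq he.symm
  have hlim : ∀ᵐ ω ∂P, Filter.Tendsto (fun n => X (j n) ω) Filter.atTop (nhds (g ω)) := by
    filter_upwards [hg_le, hmono, hbdd_ae, ae_all_iff.2 fun n => hg_ub (j n)] with ω h1 h2 h3 h4
    rw [le_antisymm h1 (ciSup_le h4)]
    exact tendsto_atTop_ciSup h2 h3
  have hlim_int := integral_tendsto_of_tendsto_of_monotone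
    (fun n => hX_int (j n)) hg_int hmono hlim
  obtain ⟨n, hn⟩ := (hlim_int.eventually (lt_mem_nhds (sub_lt_self _ hε))).exists
  exact ⟨j n, by linarith⟩

/-- for an upward-directed nonempty family `(X i)` of integrable random
variables with (integrable, measurable) essential supremum `g`, the conditional
expectation `E[g|𝓖]` is an essential supremum of the family `(E[X i|𝓖])`: the essential
supremum commutes with conditional expectation. -/
theorem stmt6 {Ω : Type*} {m mΩ : MeasurableSpace Ω} (hm : m ≤ mΩ)
    (P : @Measure Ω mΩ) [IsProbabilityMeasure P]
    {I : Type*} [Nonempty I] (X : I → Ω → ℝ)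
    (hX_int : ∀ i, Integrable (X i) P)
    (hdir : ∀ i j : I, ∃ k : I, ∀ᵐ ω ∂P, max (X i ω) (X j ω) ≤ X k ω)
    (g : Ω → ℝ) (hg_int : Integrable g P) (hg_meas : Measurable g)
    (hg_ub : ∀ i, ∀ᵐ ω ∂P, X i ω ≤ g ω)
    (hg_lub : ∀ h : Ω → ℝ, Measurable h → (∀ i, ∀ᵐ ω ∂P, X i ω ≤ h ω) →
      ∀ᵐ ω ∂P, g ω ≤ h ω) :
    (∀ i, ∀ᵐ ω ∂P, (P[X i|m]) ω ≤ (P[g|m]) ω) ∧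
    (∀ h : Ω → ℝ, Measurable[m] h → (∀ i, ∀ᵐ ω ∂P, (P[X i|m]) ω ≤ h ω) →
      ∀ᵐ ω ∂P, (P[g|m]) ω ≤ h ω) := by
  have hmono : ∀ i, ∀ᵐ ω ∂P, (P[X i|m]) ω ≤ (P[g|m]) ω := fun i =>
    condExp_mono (hX_int i) hg_int (hg_ub i)
  refine ⟨hmono, fun h hh hub => ?_⟩
  have hzero : ∫⁻ ω, ENNReal.ofReal ((P[g|m]) ω - h ω) ∂P = 0 := by
    refine le_antisymm (ENNReal.le_of_forall_pos_le_add fun ε hε _ => ?_) zero_le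
    obtain ⟨i, hi⟩ := exists_integral_lt_of_directed_essSup hX_int hdir hg_int hg_ub hg_lub
      (NNReal.coe_pos.2 hε)
    have hnonneg : 0 ≤ᵐ[P] fun ω => (P[g|m]) ω - (P[X i|m]) ω := by
      filter_upwards [hmono i] with ω hω
      exact sub_nonneg.2 hω
    calc
      _ ≤ ∫⁻ ω, ENNReal.ofReal ((P[g|m]) ω - (P[X i|m]) ω) ∂P := by
        apply lintegral_mono_ae
        filter_upwards [hub i] with ω hω
        exact ENNReal.ofReal_le_ofReal (sub_le_sub_left hω _)
      _ = ENNReal.ofReal (∫ ω, ((P[g|m]) ω - (P[X i|m]) ω) ∂P) :=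
        (ofReal_integral_eq_lintegral_ofReal
          (integrable_condExp.sub integrable_condExp) hnonneg).symm
      _ ≤ 0 + ε := by
        rw [integral_sub integrable_condExp integrable_condExp, integral_condExp hm,
          integral_condExp hm, zero_add, ← ENNReal.ofReal_coe_nnreal]
        exact ENNReal.ofReal_le_ofReal hi.le
  exact ae_le_of_lintegral_ofReal_sub_eq_zero integrable_condExp.aemeasurable
    (hh.mono hm le_rfl).aemeasurable hzero
end

section
/- Let A be a nonempty compact subset of C(ℝ, ℝ) (compact-open topology) that is upward directed for the pointwise order: for all f, g ∈ A there exists h ∈ A with f(x) ≤ h(x) and g(x) ≤ h(x) for all x ∈ ℝ. Then there exists ĥ ∈ A such that ĥ(x) = sup{ f(x) : f ∈ A } for every x ∈ ℝ; in particular the pointwise supremum of the family A is attained by a single member of A and is a continuous function. -/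
/-- A nonempty directed compact set in a preorder with closed upper rays has a greatest element. -/
theorem IsCompact.exists_isGreatest_of_directedOn {α : Type*} [TopologicalSpace α] [Preorder α]
    [ClosedIciTopology α] {s : Set α} (hs : IsCompact s) (hne : s.Nonempty)
    (hdir : DirectedOn (· ≤ ·) s) : ∃ a, IsGreatest s a := by
  have : Nonempty s := hne.to_subtype
  by_contra! hno
  obtain ⟨b, hb⟩ := hs.elim_directed_family_closed (fun b : s ↦ Set.Ici (b : α))
    (fun _ ↦ isClosed_Ici)
    (Set.eq_empty_of_forall_notMem fun a ⟨ha, hub⟩ ↦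
      hno a ⟨ha, fun b hb ↦ Set.mem_iInter.1 hub ⟨b, hb⟩⟩)
    (fun b c ↦ by
      obtain ⟨d, hd, hbd, hcd⟩ := hdir b b.2 c c.2
      exact ⟨⟨d, hd⟩, Set.Ici_subset_Ici.2 hbd, Set.Ici_subset_Ici.2 hcd⟩)
  exact Set.notMem_empty (b : α) (hb ▸ ⟨b.2, Set.self_mem_Ici⟩)

/-- a nonempty compact subset `A ⊆ C(ℝ, ℝ)` (compact-open topology) that is
upward directed for the pointwise order contains a member `h` realizing its pointwise
supremum: `h x = sup {f x | f ∈ A}` for every `x`. -/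
theorem stmt9 (A : Set C(ℝ, ℝ)) (hA_ne : A.Nonempty) (hA_cpt : IsCompact A)
    (hdir : ∀ f ∈ A, ∀ g ∈ A, ∃ h ∈ A, ∀ x : ℝ, f x ≤ h x ∧ g x ≤ h x) :
    ∃ h ∈ A, ∀ x : ℝ, h x = sSup ((fun f : C(ℝ, ℝ) => f x) '' A) := by
  have : ClosedIciTopology C(ℝ, ℝ) := ⟨fun f ↦ by
    simp only [Set.Ici, ContinuousMap.le_def, Set.ofPred_forall]
    exact isClosed_iInter fun x ↦
      isClosed_le continuous_const (continuous_eval_const x)⟩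
  have hdir' : DirectedOn (· ≤ ·) A := fun f hf g hg ↦ by
    obtain ⟨h, hh, hle⟩ := hdir f hf g hg
    exact ⟨h, hh, fun x ↦ (hle x).1, fun x ↦ (hle x).2⟩
  obtain ⟨h, hh, hub⟩ := hA_cpt.exists_isGreatest_of_directedOn hA_ne hdir'
  refine ⟨h, hh, fun x ↦ Eq.symm ?_⟩
  apply IsGreatest.csSup_eq
  refine ⟨⟨h, hh, rfl⟩, ?_⟩
  rintro _ ⟨f, hf, rfl⟩
  exact hub hf x
end

section
/- Let (X, 𝓐, ν) be a complete σ-finite measure space and Y a Polish space with its Borel σ-algebra; equip the space P(Y) of Borel probability measures on Y with the Borel σ-algebra of the topology of weak convergence. Let Σ be a set-valued map assigning to each x ∈ X a nonempty set Σ(x) ⊆ P(Y), whose graph { (x, μ) : μ ∈ Σ(x) } is measurable in the product σ-algebra 𝓐 ⊗ Borel(P(Y)). Let g : X × P(Y) → ℝ and v : X → ℝ be measurable, and assume that for every x ∈ X there exists μ ∈ Σ(x) with g(x, μ) = v(x). Then there exists an 𝓐-measurable map r : X → P(Y) such that r(x) ∈ Σ(x) and g(x, r(x)) = v(x) for every x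 ∈ X. -/
open MeasureTheory

open Set Filter Topology unitInterval

theorem exists_continuous_injective_baire_real :
    ∃ ψ : (ℕ → ℕ) → ℝ, Continuous ψ ∧ Function.Injective ψ := by
  let code : (ℕ → ℕ) → ℕ → Bool := fun s n => decide (s n.unpair.1 = n.unpair.2)
  refine ⟨fun s => Cardinal.cantorFunction (1 / 3) (code s), ?_, ?_⟩
  · refine continuous_tsum (u := fun n => (1 / 3 : ℝ) ^ n) (fun n => ?_)
      (summable_geometric_of_lt_one (by norm_num) (by norm_num)) (fun n s => ?_)
    · exact (continuous_of_discreteTopology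
        (f := fun m : ℕ => cond (decide (m = n.unpair.2)) ((1 / 3 : ℝ) ^ n) 0)).comp
        (continuous_apply n.unpair.1)
    · rw [Real.norm_of_nonneg (Cardinal.cantorFunctionAux_nonneg (by norm_num))]
      cases h : code s n
      · rw [Cardinal.cantorFunctionAux_false h]; positivity
      · rw [Cardinal.cantorFunctionAux_true h]
  · intro s t hst
    have hcode : code s = code t :=
      Cardinal.cantorFunction_injective (by norm_num) (by norm_num) hst
    funext i
    have h := congrFun hcode (Nat.pair i (t i))
    simpa [code] using h

/-- A continuous map on a compact subset of the Baire space has a Borel right inverse. -/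
theorem IsCompact.exists_measurable_rightInvOn {C : Type*} [TopologicalSpace C] [T2Space C]
    [MeasurableSpace C] [OpensMeasurableSpace C] {K : Set (ℕ → ℕ)} (hK : IsCompact K)
    {p : (ℕ → ℕ) → C} (hp : Continuous p) :
    ∃ s : C → ℕ → ℕ, Measurable s ∧ RightInvOn s p (p '' K) := by
  classical
  obtain ⟨ψ, hψ, hψinj⟩ := exists_continuous_injective_baire_real
  have hmin (c : C) (hc : c ∈ p '' K) : ∃ t ∈ K ∩ p ⁻¹' {c}, IsMinOn ψ (K ∩ p ⁻¹' {c}) t := by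
    obtain ⟨t, htK, rfl⟩ := hc
    exact (hK.inter_right (isClosed_singleton.preimage hp)).exists_isMinOn ⟨t, htK, rfl⟩
      hψ.continuousOn
  choose! s hs hsmin using hmin
  refine ⟨(p '' K).piecewise s fun _ => 0, ?_, fun c hc => ?_⟩
  · rw [← (hψ.measurableEmbedding hψinj).measurable_comp_iff]
    refine measurable_of_Iic fun a => ?_
    have hE : MeasurableSet (p '' K) := (hK.image hp).measurableSet
    have heq : (ψ ∘ (p '' K).piecewise s fun _ => 0) ⁻¹' Iic a =
        p '' (K ∩ ψ ⁻¹' Iic a) ∪ ((p '' K)ᶜ ∩ {_c | ψ 0 ≤ a}) := by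
      ext c
      by_cases hc : c ∈ p '' K
      · suffices ψ (s c) ≤ a ↔ c ∈ p '' (K ∩ ψ ⁻¹' Iic a) by simpa [hc] using! this
        constructor
        · exact fun h => ⟨s c, ⟨(hs c hc).1, h⟩, (hs c hc).2⟩
        · rintro ⟨t, ⟨htK, hta⟩, htc⟩
          exact (hsmin c hc ⟨htK, htc⟩).trans hta
      · have hc' : c ∉ p '' (K ∩ ψ ⁻¹' Iic a) := fun h => hc (image_mono inter_subset_left h)
        simp only [mem_preimage, Function.comp_apply, piecewise_eq_of_notMem _ _ _ hc, mem_Iic,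
          mem_union, hc', mem_inter_iff, mem_compl_iff, hc, not_false_eq_true, true_and, false_or,
          mem_ofPred_eq]
    rw [heq]
    exact ((hK.inter_right (isClosed_Iic.preimage hψ)).image hp).measurableSet.union
      (hE.compl.inter (MeasurableSet.const _))
  · rw [piecewise_eq_of_mem _ _ _ hc]
    exact (hs c hc).2

/-- If all finite truncations of a box in the Baire space meet a closed set, then so does the
box. -/
theorem exists_mem_of_forall_exists_truncation {F : Set (ℕ → ℕ)} (hF : IsClosed F) (k : ℕ → ℕ)
    (h : ∀ n, ∃ s ∈ F, ∀ i < n, s i ≤ k i) : ∃ s ∈ F, ∀ i, s i ≤ k i := by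
  choose s hsF hsk using h
  have hbox : IsCompact (univ.pi fun i => Iic (k i + ∑ n ∈ Finset.range (i + 1), s n i)) :=
    isCompact_univ_pi fun i => (finite_Iic _).isCompact
  have hmem (n : ℕ) : s n ∈ univ.pi fun i => Iic (k i + ∑ n ∈ Finset.range (i + 1), s n i) := by
    intro i _
    rcases lt_or_ge i n with hi | hi
    · exact (hsk n i hi).trans (Nat.le_add_right _ _)
    · exact (Finset.single_le_sum (f := fun n => s n i) (fun _ _ => Nat.zero_le _)
        (Finset.mem_range.2 (by omega))).trans (Nat.le_add_left _ _)
  obtain ⟨a, -, φ, hφ, ha⟩ := hbox.tendsto_subseq hmem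
  refine ⟨a, hF.mem_of_tendsto ha (Eventually.of_forall fun n => hsF _), fun i => ?_⟩
  refine le_of_tendsto (((continuous_apply i).tendsto a).comp ha) ?_
  filter_upwards [eventually_gt_atTop i] with n hn
  exact hsk (φ n) i (hn.trans_le (hφ.id_le n))

/-- The image of the Baire space under a continuous map is approximated in measure from inside
by images of compact sets. -/
theorem exists_isCompact_lt_measure_image {C : Type*} [TopologicalSpace C] [MeasurableSpace C]
    (μ : Measure C) [μ.OuterRegular] {p : (ℕ → ℕ) → C} (hp : Continuous p) {c : ENNReal}
    (hc : c < μ (range p)) : ∃ K : Set (ℕ → ℕ), IsCompact K ∧ c ≤ μ (p '' K) := by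
  have step (S : Set (ℕ → ℕ)) (n : ℕ) (hS : c < μ (p '' S)) :
      ∃ m, c < μ (p '' (S ∩ {s | s n ≤ m})) := by
    have hmono : Monotone fun m => p '' (S ∩ {s | s n ≤ m}) := fun m m' hm =>
      image_mono (inter_subset_inter_right _ fun s (hs : s n ≤ m) => hs.trans hm)
    have hunion : ⋃ m, p '' (S ∩ {s | s n ≤ m}) = p '' S := by
      rw [← image_iUnion, ← inter_iUnion,
        iUnion_eq_univ_iff.2 fun s : ℕ → ℕ => ⟨s n, le_refl (s n)⟩, inter_univ]
    rw [← hunion, hmono.measure_iUnion] at hS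
    exact lt_iSup_iff.1 hS
  choose! m hm using step
  let S : ℕ → Set (ℕ → ℕ) := fun n => n.rec univ fun n S => S ∩ {s | s n ≤ m S n}
  let k : ℕ → ℕ := fun n => m (S n) n
  have hSlt (n : ℕ) : c < μ (p '' S n) := by
    induction n with
    | zero => simpa [S] using hc
    | succ n ih => exact hm (S n) n ih
  have hSk (n : ℕ) : ∀ s ∈ S n, ∀ i < n, s i ≤ k i := by
    induction n with
    | zero => simp
    | succ n ih =>
      intro s hs i hi
      rcases Nat.lt_succ_iff_lt_or_eq.1 hi with hi | rfl
      · exact ih s hs.1 i hi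
      · exact hs.2
  refine ⟨univ.pi fun i => Iic (k i), isCompact_univ_pi fun i => (finite_Iic _).isCompact, ?_⟩
  rw [Set.measure_eq_iInf_isOpen]
  refine le_iInf₂ fun U hKU => le_iInf fun hU => ?_
  by_contra! hlt
  have hout (n : ℕ) : ∃ s ∈ (p ⁻¹' U)ᶜ, ∀ i < n, s i ≤ k i := by
    by_contra! hn
    refine (hlt.trans (hSlt n)).not_ge (measure_mono ?_)
    rintro _ ⟨s, hs, rfl⟩
    by_contra hsU
    obtain ⟨i, hi, hki⟩ := hn s hsU
    exact hki.not_ge (hSk n s hs i hi)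
  obtain ⟨s, hsU, hs⟩ := exists_mem_of_forall_exists_truncation (hU.preimage hp).isClosed_compl k hout
  exact hsU (hKU ⟨s, fun i _ => hs i, rfl⟩)

/-- A continuous map on the Baire space whose range has full outer measure has a Borel right
inverse almost everywhere. -/
theorem exists_measurable_ae_rightInverse {C : Type*} [TopologicalSpace C] [T2Space C]
    [SecondCountableTopology C] [MeasurableSpace C] [BorelSpace C]
    (μ : Measure C) [IsFiniteMeasure μ] [μ.OuterRegular] {p : (ℕ → ℕ) → C} (hp : Continuous p)
    (hrange : μ (range p) = μ univ) :
    ∃ s : C → ℕ → ℕ, Measurable s ∧ ∀ᵐ c ∂μ, p (s c) = c := by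
  classical
  have approx (n : ℕ) : ∃ s : C → ℕ → ℕ, Measurable s ∧
      μ {c | p (s c) = c}ᶜ ≤ (n + 1 : ENNReal)⁻¹ := by
    rcases eq_or_ne (μ univ) 0 with h0 | h0
    · exact ⟨fun _ => 0, measurable_const, (measure_mono (subset_univ _)).trans (by simp [h0])⟩
    have hlt : μ univ - (n + 1 : ENNReal)⁻¹ < μ (range p) := by
      rw [hrange]
      exact ENNReal.sub_lt_self (measure_ne_top _ _) h0 (by simp)
    obtain ⟨K, hK, hKμ⟩ := exists_isCompact_lt_measure_image μ hp hlt
    obtain ⟨s, hs, hsK⟩ := hK.exists_measurable_rightInvOn hp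
    refine ⟨s, hs, (measure_mono (compl_subset_compl.2 hsK)).trans ?_⟩
    rw [measure_compl (hK.image hp).measurableSet (measure_ne_top _ _)]
    exact tsub_le_iff_tsub_le.1 hKμ
  choose s hs hsμ using approx
  have hmeas (n : ℕ) : MeasurableSet {c | p (s n c) = c} :=
    measurableSet_eq_fun (hp.measurable.comp (hs n)) measurable_id
  have hex (c : C) : ∃ n, p (s n c) = c ∨ ∀ m, p (s m c) ≠ c := by
    by_cases h : ∃ n, p (s n c) = c
    · exact h.imp fun _ => Or.inl
    · exact ⟨0, Or.inr (not_exists.1 h)⟩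
  refine ⟨fun c => s (Nat.find (hex c)) c, Measurable.find hs (fun n => ?_) hex, ?_⟩
  · refine (hmeas n).union ?_
    have hall : MeasurableSet {c | ∀ m, p (s m c) ≠ c} := by
      have heq : {c | ∀ m, p (s m c) ≠ c} = ⋂ m, {c | p (s m c) = c}ᶜ := by
        ext c
        simp
      rw [heq]
      exact MeasurableSet.iInter fun m => (hmeas m).compl
    exact hall
  · have hnull : μ (⋂ n, {c | p (s n c) = c}ᶜ) = 0 := by
      refine le_antisymm (ge_of_tendsto' ENNReal.tendsto_inv_nat_nhds_zero fun n => ?_) bot_le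
      cases n with
      | zero => simp
      | succ n =>
        refine (measure_mono (iInter_subset _ n)).trans ?_
        exact_mod_cast hsμ n
    refine measure_mono_null (fun c hc => mem_iInter.2 fun n hn => hc ?_) hnull
    exact (Nat.find_spec (hex c)).resolve_right fun h => h n hn

/-- A measurable set in a product is the preimage of a measurable set in the product of the Cantor
space with the second factor. -/
theorem MeasurableSet.exists_preimage_prodMap_natBool {X Z : Type*} [MeasurableSpace X]
    [MeasurableSpace Z] {A : Set (X × Z)} (hA : MeasurableSet A) :
    ∃ φ : X → ℕ → Bool, Measurable φ ∧
      ∃ B : Set ((ℕ → Bool) × Z), MeasurableSet B ∧ Prod.map φ id ⁻¹' B = A := by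
  classical
  induction A, hA using MeasurableSpace.induction_on_inter generateFrom_prod.symm isPiSystem_prod
  case empty => exact ⟨fun _ _ => false, measurable_const, ∅, .empty, rfl⟩
  case basic A hA =>
    obtain ⟨s, hs, t, ht, rfl⟩ := hA
    refine ⟨fun x _ => decide (x ∈ s), measurable_pi_lambda _ fun _ => ?_,
      {c | c 0 = true} ×ˢ t, ?_, ?_⟩
    · exact measurable_to_bool (by simpa [preimage] using! hs)
    · exact (measurableSet_eq_fun (measurable_pi_apply 0) measurable_const).prod ht
    · ext ⟨x, z⟩
      simp
  case compl A _ ih =>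
    obtain ⟨φ, hφ, B, hB, rfl⟩ := ih
    exact ⟨φ, hφ, Bᶜ, hB.compl, rfl⟩
  case iUnion A _ _ ih =>
    choose φ hφ B hB hBA using ih
    let proj : ℕ → (ℕ → Bool) → ℕ → Bool := fun i c j => c (Nat.pair i j)
    have hproj (i : ℕ) : Measurable (proj i) :=
      measurable_pi_lambda _ fun j => measurable_pi_apply _
    refine ⟨fun x n => φ n.unpair.1 x n.unpair.2, ?_,
      ⋃ i, Prod.map (proj i) id ⁻¹' B i, ?_, ?_⟩
    · exact measurable_pi_lambda _ fun n => (measurable_pi_apply _).comp (hφ _)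
    · exact MeasurableSet.iUnion fun i => ((hproj i).prodMap measurable_id) (hB i)
    · rw [preimage_iUnion]
      refine iUnion_congr fun i => ?_
      rw [← hBA i]
      ext ⟨x, z⟩
      simp [proj]

/-- **Aumann–von Neumann measurable selection theorem**: a measurable subset of the product of a
complete σ-finite measure space with a Polish space, all of whose sections are nonempty, contains
the graph of a measurable map. -/
theorem MeasurableSet.exists_measurable_selection {X Z : Type*} [MeasurableSpace X]
    (ν : Measure X) [SigmaFinite ν] [ν.IsComplete] [TopologicalSpace Z] [PolishSpace Z]
    [MeasurableSpace Z] [BorelSpace Z] {A : Set (X × Z)} (hA : MeasurableSet A)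
    (hne : ∀ x, ∃ z, (x, z) ∈ A) : ∃ r : X → Z, Measurable r ∧ ∀ x, (x, r x) ∈ A := by
  classical
  rcases isEmpty_or_nonempty X with hX | ⟨⟨x₀⟩⟩
  · exact ⟨fun x => hX.elim x, measurable_of_empty _, fun x => hX.elim x⟩
  obtain ⟨φ, hφ, B, hB, rfl⟩ := hA.exists_preimage_prodMap_natBool
  obtain ⟨ν', hν', hνν', -⟩ := exists_isFiniteMeasure_absolutelyContinuous ν
  have hBan : AnalyticSet B := by simpa using hB.analyticSet_image measurable_id
  rw [AnalyticSet] at hBan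
  rcases hBan with rfl | ⟨h, hh, rfl⟩
  · exact absurd (hne x₀).choose_spec (by simp)
  have hrange : (ν'.map φ) (range fun t => (h t).1) = (ν'.map φ) univ := by
    rw [Measure.map_apply hφ MeasurableSet.univ, preimage_univ]
    refine le_antisymm ?_ ((measure_mono fun x _ => ?_).trans (Measure.le_map_apply hφ.aemeasurable _))
    · exact (measure_mono (subset_univ _)).trans_eq
        (by rw [Measure.map_apply hφ MeasurableSet.univ, preimage_univ])
    · obtain ⟨z, t, ht⟩ := hne x
      exact ⟨t, by simp [ht]⟩
  obtain ⟨s, hs, hsae⟩ := exists_measurable_ae_rightInverse (ν'.map φ) (continuous_fst.comp hh) hrange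
  have hgood : ∀ᵐ x ∂ν, (x, (h (s (φ x))).2) ∈ Prod.map φ id ⁻¹' range h := by
    filter_upwards [hνν'.ae_le (ae_of_ae_map hφ.aemeasurable hsae)] with x hx
    exact ⟨s (φ x), Prod.ext hx rfl⟩
  choose r₀ hr₀ using hne
  have hmeas : Measurable fun x => (h (s (φ x))).2 :=
    (continuous_snd.comp hh).measurable.comp (hs.comp hφ)
  refine ⟨fun x => if (x, (h (s (φ x))).2) ∈ Prod.map φ id ⁻¹' range h then (h (s (φ x))).2
    else r₀ x, hmeas.congr_ae (μ := ν) ?_, fun x => ?_⟩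
  · filter_upwards [hgood] with x hx
    rw [if_pos hx]
  · dsimp only
    split_ifs with hx
    exacts [hx, hr₀ x]

/-- The measures of Borel sets depend measurably on a parameter if the measures vary continuously
for weak convergence. -/
theorem Continuous.measurable_toMeasure {T K : Type*} [TopologicalSpace T] [MeasurableSpace T]
    [OpensMeasurableSpace T] [TopologicalSpace K] [HasOuterApproxClosed K] [MeasurableSpace K]
    [BorelSpace K] {f : T → ProbabilityMeasure K} (hf : Continuous f) :
    Measurable fun t => (f t : Measure K) := by
  refine Measurable.measure_of_isPiSystem_of_isProbabilityMeasure
    (BorelSpace.measurable_eq (α := K)) isPiSystem_isOpen fun G hG => ?_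
  refine (lowerSemicontinuous_iff_le_liminf.2 fun t => ?_).measurable
  exact ProbabilityMeasure.le_liminf_measure_open_of_tendsto (hf.tendsto t) hG

/-- Pushforward along an embedding is an embedding for weak convergence. -/
theorem Topology.IsEmbedding.probabilityMeasure_map {Y K : Type*} [TopologicalSpace Y]
    [MeasurableSpace Y] [BorelSpace Y] [HasOuterApproxClosed Y] [TopologicalSpace K]
    [MeasurableSpace K] [BorelSpace K] [HasOuterApproxClosed K]
    [FirstCountableTopology (ProbabilityMeasure K)] {i : Y → K} (hi : IsEmbedding i) :
    IsEmbedding fun μ : ProbabilityMeasure Y => μ.map hi.continuous.measurable.aemeasurable := by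
  suffices h : IsInducing fun μ : ProbabilityMeasure Y =>
      μ.map hi.continuous.measurable.aemeasurable from ⟨h, h.injective⟩
  refine isInducing_iff_nhds.2 fun μ => le_antisymm ?_ ?_
  · exact ((ProbabilityMeasure.continuous_map hi.continuous).tendsto μ).le_comap
  · refine tendsto_id'.1 (tendsto_of_forall_isOpen_le_liminf' fun G hG => ?_)
    obtain ⟨G', hG', rfl⟩ := hi.isOpen_iff.1 hG
    have hmap (κ : ProbabilityMeasure Y) : (κ : Measure Y) (i ⁻¹' G') =
        (κ.map hi.continuous.measurable.aemeasurable : Measure K) G' := by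
      rw [ProbabilityMeasure.toMeasure_map,
        Measure.map_apply hi.continuous.measurable hG'.measurableSet]
    simp only [hmap]
    exact ProbabilityMeasure.le_liminf_measure_open_of_tendsto tendsto_comap hG'

/-- The probability measures on a Polish space, with the Borel σ-algebra of weak convergence, embed
measurably into those on the Hilbert cube. -/
theorem exists_measurableEmbedding_probabilityMeasure_hilbertCube (Y : Type*) [TopologicalSpace Y]
    [PolishSpace Y] [MeasurableSpace Y] [BorelSpace Y] :
    ∃ f : ProbabilityMeasure Y → ProbabilityMeasure (ℕ → I),
      @MeasurableEmbedding _ _ (borel _) (borel _) f := by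
  let : MeasurableSpace (ProbabilityMeasure Y) := borel _
  let : MeasurableSpace (ProbabilityMeasure (ℕ → I)) := borel _
  have : BorelSpace (ProbabilityMeasure Y) := ⟨rfl⟩
  have : BorelSpace (ProbabilityMeasure (ℕ → I)) := ⟨rfl⟩
  let := TopologicalSpace.upgradeIsCompletelyMetrizable Y
  obtain ⟨i, hi⟩ := Metric.PiNatEmbed.exists_embedding_to_hilbert_cube (X := Y)
  have him := hi.continuous.measurableEmbedding hi.injective
  refine ⟨_, hi.probabilityMeasure_map.measurableEmbedding ?_⟩
  have heq : range (fun μ : ProbabilityMeasure Y =>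
      μ.map hi.continuous.measurable.aemeasurable) =
      {κ : ProbabilityMeasure (ℕ → I) | (κ : Measure (ℕ → I)) (range i)ᶜ = 0} := by
    ext κ
    constructor
    · rintro ⟨μ, rfl⟩
      rw [mem_ofPred_eq]
      rw [ProbabilityMeasure.toMeasure_map, him.map_apply]
      simp
    · intro hκ
      have hres : ((κ : Measure (ℕ → I)).comap i).map i = κ := by
        rw [him.map_comap]
        exact Measure.restrict_eq_self_of_ae_mem (mem_ae_iff.2 hκ)
      have hprob : IsProbabilityMeasure ((κ : Measure (ℕ → I)).comap i) := by
        constructor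
        rw [← preimage_univ (f := i), ← him.map_apply, hres, measure_univ]
      exact ⟨⟨_, hprob⟩, Subtype.ext hres⟩
  rw [heq]
  exact (Measure.measurable_coe him.measurableSet_range.compl).comp
    continuous_id.measurable_toMeasure (measurableSet_singleton 0)

/-- measurable selection: let `(X, 𝓐, ν)` be a complete σ-finite measure
space, `Y` Polish, `P(Y)` the probability measures on `Y` with the Borel σ-algebra of the
weak topology.  If `Sig` is a nonempty-valued multifunction `X → Set (P(Y))` with
measurable graph, `g : X × P(Y) → ℝ` and `v : X → ℝ` are measurable, and for every `x`
some `μ ∈ Sig x` attains `g (x, μ) = v x`, then there is a measurable selection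
`r : X → P(Y)` with `r x ∈ Sig x` and `g (x, r x) = v x` for every `x`. -/
theorem stmt11 {X Y : Type*} [mX : MeasurableSpace X]
    (ν : Measure X) [SigmaFinite ν] (hν : ν.IsComplete)
    [TopologicalSpace Y] [PolishSpace Y] [MeasurableSpace Y] [BorelSpace Y]
    (Sig : X → Set (ProbabilityMeasure Y)) (hSne : ∀ x, (Sig x).Nonempty)
    (hSgraph : @MeasurableSet (X × ProbabilityMeasure Y)
      (@Prod.instMeasurableSpace _ _ mX (borel (ProbabilityMeasure Y)))
      {p : X × ProbabilityMeasure Y | p.2 ∈ Sig p.1})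
    (g : X × ProbabilityMeasure Y → ℝ)
    (hg : @Measurable (X × ProbabilityMeasure Y) ℝ
      (@Prod.instMeasurableSpace _ _ mX (borel (ProbabilityMeasure Y))) _ g)
    (v : X → ℝ) (hv : Measurable v)
    (hattain : ∀ x, ∃ μ ∈ Sig x, g (x, μ) = v x) :
    ∃ r : X → ProbabilityMeasure Y,
      @Measurable X (ProbabilityMeasure Y) mX (borel (ProbabilityMeasure Y)) r ∧
      ∀ x, r x ∈ Sig x ∧ g (x, r x) = v x := by
  let : MeasurableSpace (ProbabilityMeasure Y) := borel _
  let : MeasurableSpace (ProbabilityMeasure (ℕ → I)) := borel _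
  have : BorelSpace (ProbabilityMeasure (ℕ → I)) := ⟨rfl⟩
  let := TopologicalSpace.metrizableSpaceMetric (ProbabilityMeasure (ℕ → I))
  have : PolishSpace (ProbabilityMeasure (ℕ → I)) := inferInstance
  obtain ⟨f, hf⟩ := exists_measurableEmbedding_probabilityMeasure_hilbertCube Y
  let A : Set (X × ProbabilityMeasure Y) := {p | p.2 ∈ Sig p.1} ∩ {p | g p = v p.1}
  have hA : MeasurableSet A :=
    hSgraph.inter (measurableSet_eq_fun hg (hv.comp measurable_fst))
  have hA' : MeasurableSet (Prod.map id f '' A) :=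
    (MeasurableEmbedding.id.prodMap hf).measurableSet_image.2 hA
  obtain ⟨r', hr', hrA⟩ := hA'.exists_measurable_selection ν fun x => by
    obtain ⟨μ, hμ, hgμ⟩ := hattain x
    exact ⟨f μ, (x, μ), ⟨hμ, hgμ⟩, rfl⟩
  have hlift (x : X) : ∃ μ, (x, μ) ∈ A ∧ f μ = r' x := by
    obtain ⟨⟨x', μ⟩, hμ, heq⟩ := hrA x
    obtain ⟨rfl, hfμ⟩ := Prod.mk.inj heq
    exact ⟨μ, hμ, hfμ⟩
  choose r hr hfr using hlift
  refine ⟨r, hf.measurable_comp_iff.1 ?_, fun x => hr x⟩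
  rwa [show f ∘ r = r' from funext hfr]
end
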